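/- arXiv:1709.06735 — 2 statements merged into one kernel-verified Lean document; each statement's English description precedes it below -/
import Mathlib

section
/- For every integer a ≥ 4, one has p_{-2}(a) · p_{-2}(1) > p_{-2}(a + 1); equivalently, 2 · p_{-2}(a) > p_{-2}(a + 1). -/
/-- A `k`-colored partition of `n`: a multiset of pairs `(m, c)` where `m` is a positive
part size and `c ∈ {0, …, k-1}` is a color (color `j` of the paper corresponds to `j - 1`
here), such that the part sizes sum to `n`. -/
structure ColoredPartition (k n : ℕ) where
  parts : Multiset (ℕ × ℕ)
  parts_pos : ∀ p ∈ parts, 0 < p.1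
  parts_color : ∀ p ∈ parts, p.2 < k
  parts_sum : (parts.map Prod.fst).sum = n

/-- `p_{-k}(n)`, the number of `k`-colored partitions of `n`. -/
noncomputable def coloredPartitions (k n : ℕ) : ℕ := Nat.card (ColoredPartition k n)

/-- `p_{-k}(n | avoiding s)`: the number of `k`-colored partitions of `n` containing
no part belonging to the set `s` of (size, color) pairs. -/
noncomputable def coloredPartitionsAvoiding (k n : ℕ) (s : Set (ℕ × ℕ)) : ℕ :=
  Nat.card {p : ColoredPartition k n // ∀ x ∈ s, x ∉ p.parts}

/-- The underlying multisets of the two-colored partitions of `n`. -/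
def twoColoredParts (n : ℕ) : Set (Multiset (ℕ × ℕ)) :=
  {s | (∀ p ∈ s, 0 < p.1 ∧ p.2 < 2) ∧ (s.map Prod.fst).sum = n}

theorem coloredPartitions_two (n : ℕ) :
    coloredPartitions 2 n = (twoColoredParts n).ncard := by
  rw [coloredPartitions, ← Nat.card_coe_set_eq]
  exact Nat.card_congr
    { toFun := fun p => ⟨p.parts, fun x hx => ⟨p.parts_pos x hx, p.parts_color x hx⟩, p.parts_sum⟩
      invFun := fun s => ⟨s.1, fun x hx => (s.2.1 x hx).1, fun x hx => (s.2.1 x hx).2, s.2.2⟩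
      left_inv := fun _ => rfl
      right_inv := fun _ => rfl }

theorem finite_twoColoredParts (n : ℕ) : (twoColoredParts n).Finite := by
  refine (Set.finite_Iic (n • (Finset.range (n + 1) ×ˢ Finset.range 2).val)).subset ?_
  rintro s ⟨hs, hsum⟩
  rw [Set.mem_Iic, Multiset.le_iff_count]
  intro p
  by_cases hp : p ∈ s
  · have hle : p.1 ≤ n := hsum ▸ Multiset.le_sum_of_mem (Multiset.mem_map_of_mem Prod.fst hp)
    have hmem : p ∈ Finset.range (n + 1) ×ˢ Finset.range 2 := by
      simp only [Finset.mem_product, Finset.mem_range]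
      exact ⟨by omega, (hs p hp).2⟩
    have hcard : s.card ≤ n := by
      have := Multiset.card_nsmul_le_sum (s := s.map Prod.fst) (a := 1) (by
        intro x hx
        obtain ⟨q, hq, rfl⟩ := Multiset.mem_map.1 hx
        exact (hs q hq).1)
      simpa [hsum] using this
    rw [Multiset.count_nsmul, Multiset.count_eq_one_of_mem (Finset.nodup _) hmem, mul_one]
    exact (Multiset.count_le_card p s).trans hcard
  · simp [Multiset.count_eq_zero_of_notMem hp]

theorem cons_mem_twoColoredParts_iff {m c n : ℕ} {s : Multiset (ℕ × ℕ)} :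
    (m, c) ::ₘ s ∈ twoColoredParts (m + n) ↔ 0 < m ∧ c < 2 ∧ s ∈ twoColoredParts n := by
  simp only [twoColoredParts, Set.mem_ofPred_eq, Multiset.forall_mem_cons, Multiset.map_cons,
    Multiset.sum_cons, add_right_inj, and_assoc]

theorem add_replicate_one_mem_twoColoredParts {i c n : ℕ} {s : Multiset (ℕ × ℕ)} (hc : c < 2)
    (hs : s ∈ twoColoredParts n) :
    s + Multiset.replicate i (1, c) ∈ twoColoredParts (n + i) := by
  refine ⟨fun p hp => ?_, by simp [hs.2]⟩
  rcases Multiset.mem_add.1 hp with h | h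
  · exact hs.1 p h
  · rw [Multiset.eq_of_mem_replicate h]
    exact ⟨one_pos, hc⟩

/-- The two-colored partitions of `n` without parts equal to `1`. -/
def twoColoredPartsNoOnes (n : ℕ) : Set (Multiset (ℕ × ℕ)) :=
  {s ∈ twoColoredParts n | ∀ c, (1, c) ∉ s}

/-- Merge the parts equal to `1` into larger parts, increasing the sum by `2`. -/
def mergeOnes (s : Multiset (ℕ × ℕ)) : Multiset (ℕ × ℕ) :=
  let i := s.count (1, 0)
  let j := s.count (1, 1)
  let t := s.filter (fun p => p.1 ≠ 1)
  if i = 0 then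
    if j = 0 then (2, 0) ::ₘ t else (j + 2, 1) ::ₘ t
  else if j = 0 then (i + 2, 0) ::ₘ t
  else (2, 1) ::ₘ (i + j, if j = 1 ∧ i ≠ 1 then 0 else 1) ::ₘ t

theorem mergeOnes_add_replicate {s : Multiset (ℕ × ℕ)} (hs : ∀ c, (1, c) ∉ s) (i j : ℕ) :
    mergeOnes (s + Multiset.replicate i (1, 0) + Multiset.replicate j (1, 1)) =
      if i = 0 then
        if j = 0 then (2, 0) ::ₘ s else (j + 2, 1) ::ₘ s
      else if j = 0 then (i + 2, 0) ::ₘ s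
      else (2, 1) ::ₘ (i + j, if j = 1 ∧ i ≠ 1 then 0 else 1) ::ₘ s := by
  have hfilter : s.filter (fun p => p.1 ≠ 1) = s := by
    refine Multiset.filter_eq_self.2 ?_
    rintro ⟨m, c⟩ hp rfl
    exact hs c hp
  have hrep (k c : ℕ) : (Multiset.replicate k (1, c)).filter (fun p => p.1 ≠ 1) = 0 :=
    Multiset.filter_eq_nil.2 fun p hp => by simp [Multiset.eq_of_mem_replicate hp]
  simp only [mergeOnes, Multiset.filter_add, hfilter, hrep, Multiset.count_add,
    Multiset.count_eq_zero_of_notMem (hs _), Multiset.count_replicate]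
  simp

/-- Every two-colored partition of `n + 2` without ones is the image under `mergeOnes` of a
two-colored partition of `n` other than `2 + 1 + ⋯ + 1` in color `0`. -/
theorem exists_mergeOnes_eq {n : ℕ} (hn : 3 ≤ n) {s : Multiset (ℕ × ℕ)}
    (hs : s ∈ twoColoredPartsNoOnes (n + 2)) :
    ∃ t ∈ twoColoredParts n,
      t ≠ (2, 0) ::ₘ Multiset.replicate (n - 2) (1, 0) ∧ mergeOnes t = s := by
  obtain ⟨hP, h1⟩ := hs
  have hsize {m c : ℕ} (h : (m, c) ∈ s) : 2 ≤ m ∧ c < 2 := by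
    have h2 : 0 < m ∧ c < 2 := hP.1 _ h
    have h3 : m ≠ 1 := by
      rintro rfl
      exact h1 c h
    omega
  by_cases h20 : (2, 0) ∈ s
  · obtain ⟨t, rfl⟩ := Multiset.exists_cons_of_mem h20
    have h1t : ∀ c, (1, c) ∉ t := fun c h => h1 c (Multiset.mem_cons_of_mem h)
    rw [add_comm, cons_mem_twoColoredParts_iff] at hP
    refine ⟨t, hP.2.2, ?_, by simpa using mergeOnes_add_replicate h1t 0 0⟩
    rintro rfl
    exact h1t 0 (Multiset.mem_cons_of_mem (Multiset.mem_replicate.2 ⟨by omega, rfl⟩))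
  have hne {u : Multiset (ℕ × ℕ)} (i j : ℕ) (h : (2, 0) ∉ u) :
      u + Multiset.replicate i (1, 0) + Multiset.replicate j (1, 1) ≠
        (2, 0) ::ₘ Multiset.replicate (n - 2) (1, 0) := by
    intro heq
    have h2 := heq ▸ Multiset.mem_cons_self (2, 0) (Multiset.replicate (n - 2) (1, 0))
    simp [h, Multiset.mem_replicate] at h2
  have hmem {u : Multiset (ℕ × ℕ)} {k : ℕ} (i j : ℕ) (h : u ∈ twoColoredParts k)
      (hk : k + i + j = n) :
      u + Multiset.replicate i (1, 0) + Multiset.replicate j (1, 1) ∈ twoColoredParts n :=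
    hk ▸ add_replicate_one_mem_twoColoredParts one_lt_two
      (add_replicate_one_mem_twoColoredParts two_pos h)
  have hnonempty {k : ℕ} {t : Multiset (ℕ × ℕ)} (hk : 0 < k) (ht : t ∈ twoColoredParts k) :
      ∃ m c u l, t = (m, c) ::ₘ u ∧ k = m + l ∧ u ∈ twoColoredParts l := by
    obtain ⟨⟨m, c⟩, hmc⟩ : ∃ p, p ∈ t := by
      apply Multiset.exists_mem_of_ne_zero
      rintro rfl
      have : 0 = k := ht.2
      omega
    obtain ⟨u, rfl⟩ := Multiset.exists_cons_of_mem hmc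
    have hsum : m + (u.map Prod.fst).sum = k := by simpa using ht.2
    exact ⟨m, c, u, _, rfl, hsum.symm, fun p hp => ht.1 p (Multiset.mem_cons_of_mem hp), rfl⟩
  by_cases h21 : (2, 1) ∈ s
  · obtain ⟨t, rfl⟩ := Multiset.exists_cons_of_mem h21
    rw [add_comm, cons_mem_twoColoredParts_iff] at hP
    obtain ⟨m, c, u, l, rfl, rfl, hu⟩ := hnonempty (by omega) hP.2.2
    have h1u : ∀ c, (1, c) ∉ u := fun c h => h1 c (by simp [h])
    have h20u : (2, 0) ∉ u := fun h => h20 (by simp [h])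
    obtain ⟨hm, hc⟩ := hsize (m := m) (c := c) (by simp)
    interval_cases c
    · have hm2 : m ≠ 2 := by
        rintro rfl
        exact h20 (by simp)
      refine ⟨_, hmem (m - 1) 1 hu (by omega), hne _ _ h20u, ?_⟩
      rw [mergeOnes_add_replicate h1u, if_neg (by omega), if_neg one_ne_zero,
        if_pos (by omega), Nat.sub_add_cancel (by omega)]
    · refine ⟨_, hmem 1 (m - 1) hu (by omega), hne _ _ h20u, ?_⟩
      rw [mergeOnes_add_replicate h1u, if_neg one_ne_zero, if_neg (by omega),
        if_neg (by omega), Nat.add_sub_cancel' (by omega)]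
  · obtain ⟨m, c, u, l, rfl, hl, hu⟩ := hnonempty (by omega) hP
    have h1u : ∀ c, (1, c) ∉ u := fun c h => h1 c (by simp [h])
    have h20u : (2, 0) ∉ u := fun h => h20 (by simp [h])
    obtain ⟨hm, hc⟩ := hsize (m := m) (c := c) (by simp)
    have hm2 : m ≠ 2 := by
      rintro rfl
      interval_cases c
      exacts [h20 (by simp), h21 (by simp)]
    interval_cases c
    · refine ⟨_, hmem (m - 2) 0 hu (by omega), hne _ _ h20u, ?_⟩
      rw [mergeOnes_add_replicate h1u, if_neg (by omega), if_pos rfl,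
        Nat.sub_add_cancel (by omega)]
    · refine ⟨_, hmem 0 (m - 2) hu (by omega), hne _ _ h20u, ?_⟩
      rw [mergeOnes_add_replicate h1u, if_pos rfl, if_neg (by omega),
        Nat.sub_add_cancel (by omega)]

theorem ncard_noOnes_lt {n : ℕ} (hn : 3 ≤ n) :
    (twoColoredPartsNoOnes (n + 2)).ncard < (twoColoredParts n).ncard := by
  set b : Multiset (ℕ × ℕ) := (2, 0) ::ₘ Multiset.replicate (n - 2) (1, 0)
  have hb : b ∈ twoColoredParts n := by
    have h0 : (0 : Multiset (ℕ × ℕ)) ∈ twoColoredParts 0 := by simp [twoColoredParts]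
    have h := add_replicate_one_mem_twoColoredParts (i := n - 2) (c := 0) two_pos h0
    obtain ⟨k, rfl⟩ : ∃ k, n = 2 + k := ⟨n - 2, by omega⟩
    exact cons_mem_twoColoredParts_iff.2 ⟨two_pos, two_pos, by simpa using h⟩
  have hfin : (twoColoredParts n \ {b}).Finite := (finite_twoColoredParts n).sdiff
  calc (twoColoredPartsNoOnes (n + 2)).ncard
      ≤ (mergeOnes '' (twoColoredParts n \ {b})).ncard := by
        refine Set.ncard_le_ncard (fun s hs => ?_) (hfin.image _)
        obtain ⟨t, ht, htb, rfl⟩ := exists_mergeOnes_eq hn hs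
        exact ⟨t, ⟨ht, htb⟩, rfl⟩
    _ ≤ (twoColoredParts n \ {b}).ncard := Set.ncard_image_le hfin
    _ < (twoColoredParts n).ncard :=
        Set.ncard_sdiff_singleton_lt_of_mem hb (finite_twoColoredParts n)

theorem ncard_succ_le (n : ℕ) :
    (twoColoredParts (n + 2)).ncard + (twoColoredParts n).ncard ≤
      2 * (twoColoredParts (n + 1)).ncard + (twoColoredPartsNoOnes (n + 2)).ncard := by
  set A : Set (Multiset (ℕ × ℕ)) := {s ∈ twoColoredParts (n + 1) | (1, 0) ∉ s} with hA
  have hfin := finite_twoColoredParts (n + 1)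
  have hAfin : A.Finite := hfin.subset (Set.sep_subset _ _)
  have hcons (c : ℕ) : Function.Injective (fun s : Multiset (ℕ × ℕ) => (1, c) ::ₘ s) :=
    fun _ _ h => (Multiset.cons_inj_right _).1 h
  have hsplit : A.ncard + (twoColoredParts n).ncard ≤ (twoColoredParts (n + 1)).ncard := by
    rw [← Set.ncard_image_of_injective (twoColoredParts n) (hcons 0),
      ← Set.ncard_union_eq _ hAfin ((finite_twoColoredParts n).image _)]
    · refine Set.ncard_le_ncard (Set.union_subset (Set.sep_subset _ _) ?_) hfin
      rintro _ ⟨s, hs, rfl⟩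
      rw [add_comm]
      exact cons_mem_twoColoredParts_iff.2 ⟨one_pos, two_pos, hs⟩
    · rw [Set.disjoint_left]
      rintro _ hs ⟨t, -, rfl⟩
      exact hs.2 (Multiset.mem_cons_self _ _)
  have hcover : twoColoredParts (n + 2) ⊆
      (fun s => (1, 0) ::ₘ s) '' twoColoredParts (n + 1) ∪ (fun s => (1, 1) ::ₘ s) '' A ∪
        twoColoredPartsNoOnes (n + 2) := by
    intro s hs
    by_cases h0 : (1, 0) ∈ s
    · obtain ⟨t, rfl⟩ := Multiset.exists_cons_of_mem h0
      rw [show n + 2 = 1 + (n + 1) by ring, cons_mem_twoColoredParts_iff] at hs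
      exact .inl (.inl ⟨t, hs.2.2, rfl⟩)
    by_cases h1 : (1, 1) ∈ s
    · obtain ⟨t, rfl⟩ := Multiset.exists_cons_of_mem h1
      rw [show n + 2 = 1 + (n + 1) by ring, cons_mem_twoColoredParts_iff] at hs
      exact .inl (.inr ⟨t, ⟨hs.2.2, fun h => h0 (Multiset.mem_cons_of_mem h)⟩, rfl⟩)
    · refine .inr ⟨hs, fun c hc => ?_⟩
      have : c < 2 := (hs.1 _ hc).2
      interval_cases c
      exacts [h0 hc, h1 hc]
  have hle := Set.ncard_le_ncard hcover (((hfin.image _).union (hAfin.image _)).union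
    ((finite_twoColoredParts (n + 2)).subset (Set.sep_subset _ _)))
  have h1 := Set.ncard_union_le
    ((fun s => (1, 0) ::ₘ s) '' twoColoredParts (n + 1) ∪ (fun s => (1, 1) ::ₘ s) '' A)
    (twoColoredPartsNoOnes (n + 2))
  have h2 := Set.ncard_union_le
    ((fun s => (1, 0) ::ₘ s) '' twoColoredParts (n + 1)) ((fun s => (1, 1) ::ₘ s) '' A)
  rw [Set.ncard_image_of_injective _ (hcons 0), Set.ncard_image_of_injective _ (hcons 1)] at h2
  omega

theorem two_le_coloredPartitions_two_one : 2 ≤ coloredPartitions 2 1 := by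
  rw [coloredPartitions_two,
    ← Set.ncard_pair (a := ({(1, 0)} : Multiset (ℕ × ℕ))) (b := {(1, 1)}) (by simp)]
  refine Set.ncard_le_ncard ?_ (finite_twoColoredParts 1)
  rintro s (rfl | rfl) <;> simp [twoColoredParts]

theorem two_colored_add_one (a : ℕ) (ha : 4 ≤ a) :
    coloredPartitions 2 a * coloredPartitions 2 1 > coloredPartitions 2 (a + 1) ∧
    2 * coloredPartitions 2 a > coloredPartitions 2 (a + 1) := by
  have key : 2 * coloredPartitions 2 a > coloredPartitions 2 (a + 1) := by
    obtain ⟨n, rfl⟩ : ∃ n, a = n + 1 := ⟨a - 1, by omega⟩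
    have h1 := ncard_succ_le n
    have h2 := ncard_noOnes_lt (n := n) (by omega)
    simp only [coloredPartitions_two, add_assoc, Nat.reduceAdd]
    omega
  have h := Nat.mul_le_mul_left (coloredPartitions 2 a) two_le_coloredPartitions_two_one
  exact ⟨by omega, key⟩
end

section
/- For every integer a ≥ 2, one has p_{-3}(a) · p_{-3}(1) > p_{-3}(a + 1); equivalently, 3 · p_{-3}(a) > p_{-3}(a + 1). -/
namespace ColoredPartition

theorem parts_injective {k n : ℕ} :
    Function.Injective (parts : ColoredPartition k n → Multiset (ℕ × ℕ)) := by
  rintro ⟨s, _, _, _⟩ ⟨t, _, _, _⟩ rfl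
  rfl

theorem card_parts_le {k n : ℕ} (p : ColoredPartition k n) : p.parts.card ≤ n := by
  have h : ∀ x ∈ p.parts.map Prod.fst, 1 ≤ x := by
    intro x hx
    obtain ⟨y, hy, rfl⟩ := Multiset.mem_map.1 hx
    exact p.parts_pos y hy
  simpa [p.parts_sum] using Multiset.card_nsmul_le_sum h

instance (k n : ℕ) : Finite (ColoredPartition k n) := by
  refine Set.finite_univ_iff.1 (Set.Finite.of_finite_image (f := parts)
    ((Set.finite_Iic (n • (Finset.range (n + 1) ×ˢ Finset.range k).val)).subset ?_)
    parts_injective.injOn)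
  rintro _ ⟨p, -, rfl⟩
  refine Multiset.le_iff_count.2 fun x => ?_
  by_cases hx : x ∈ p.parts
  · have hle : x.1 ≤ n :=
      p.parts_sum ▸ Multiset.le_sum_of_mem (Multiset.mem_map_of_mem Prod.fst hx)
    have hmem : x ∈ (Finset.range (n + 1) ×ˢ Finset.range k).val := by
      rw [Finset.mem_val, Finset.mem_product, Finset.mem_range, Finset.mem_range]
      exact ⟨Nat.lt_succ_of_le hle, p.parts_color x hx⟩
    rw [Multiset.count_nsmul]
    calc p.parts.count x ≤ n := (Multiset.count_le_card _ _).trans p.card_parts_le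
      _ ≤ _ := Nat.le_mul_of_pos_right n (Multiset.count_pos.2 hmem)
  · simp [Multiset.count_eq_zero_of_notMem hx]

/-- The partition of `1` into a single part of color `c`. -/
def single {k : ℕ} (c : Fin k) : ColoredPartition k 1 where
  parts := {(1, (c : ℕ))}
  parts_pos := by simp
  parts_color := by simp
  parts_sum := by simp

theorem single_bijective {k : ℕ} :
    Function.Bijective (single : Fin k → ColoredPartition k 1) := by
  constructor
  · intro c d h
    simpa [single, Fin.ext_iff] using congrArg parts h
  · intro p
    have hsum := p.parts_sum
    have hcard := p.card_parts_le
    have hne : p.parts.card ≠ 0 := by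
      intro h
      simp [Multiset.card_eq_zero.1 h] at hsum
    obtain ⟨⟨m, c⟩, hx⟩ := Multiset.card_eq_one.1 (by omega : p.parts.card = 1)
    have hc : c < k := p.parts_color (m, c) (by simp [hx])
    have hm : m = 1 := by simpa [hx] using hsum
    exact ⟨⟨c, hc⟩, parts_injective (by simp [single, hx, hm])⟩

/-- `Shrinks p c q` relates a partition `p` of `n + 1` to a color `c` and a partition `q` of `n`
obtained from `p` either by removing a part `1` whose color `c` is minimal among the parts `1`,
or, if `p` has no part `1`, by splitting a part of size `m + 2` and color `j` into `m + 1` parts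
`1`, where `c` and the color of the new parts together encode `j`. -/
def Shrinks {n : ℕ} (p : ColoredPartition 3 (n + 1)) (c : Fin 3) (q : ColoredPartition 3 n) :
    Prop :=
  (p.parts = (1, (c : ℕ)) ::ₘ q.parts ∧ ∀ d < (c : ℕ), (1, d) ∉ q.parts) ∨
  ∃ (m j : ℕ) (t : Multiset (ℕ × ℕ)), j < 3 ∧ (∀ d, (1, d) ∉ t) ∧
    p.parts = (m + 2, j) ::ₘ t ∧ (c : ℕ) = (j + 3) / 2 ∧
    q.parts = Multiset.replicate (m + 1) (1, j / 2) + t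

theorem exists_shrinks {n : ℕ} (p : ColoredPartition 3 (n + 1)) :
    ∃ x : Fin 3 × ColoredPartition 3 n, Shrinks p x.1 x.2 := by
  have hpos := p.parts_pos
  have hcol := p.parts_color
  have hsum := p.parts_sum
  by_cases h : ∃ d, (1, d) ∈ p.parts
  · classical
    obtain ⟨t, ht⟩ := Multiset.exists_cons_of_mem (Nat.find_spec h)
    have hmin : ∀ d < Nat.find h, (1, d) ∉ t := fun d hd hdt =>
      Nat.find_min h hd (ht ▸ Multiset.mem_cons_of_mem hdt)
    have hc : Nat.find h < 3 := hcol _ (Nat.find_spec h)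
    generalize Nat.find h = c at ht hmin hc
    rw [ht] at hpos hcol hsum
    simp only [Multiset.map_cons, Multiset.sum_cons] at hsum
    exact ⟨(⟨c, hc⟩, ⟨t, fun x hx => hpos x (Multiset.mem_cons_of_mem hx),
      fun x hx => hcol x (Multiset.mem_cons_of_mem hx), by omega⟩), Or.inl ⟨ht, hmin⟩⟩
  · push Not at h
    have hne : p.parts ≠ 0 := by
      intro h0
      simp [h0] at hsum
    obtain ⟨⟨m, j⟩, hmj⟩ := Multiset.exists_mem_of_ne_zero hne
    have hj : j < 3 := hcol _ hmj
    have hm : 2 ≤ m := by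
      have h0 : 0 < m := hpos _ hmj
      have h1 : m ≠ 1 := by
        rintro rfl
        exact h j hmj
      omega
    obtain ⟨m, rfl⟩ := Nat.exists_eq_add_of_le' hm
    obtain ⟨t, ht⟩ := Multiset.exists_cons_of_mem hmj
    rw [ht] at hpos hcol hsum h
    simp only [Multiset.map_cons, Multiset.sum_cons] at hsum
    refine ⟨(⟨(j + 3) / 2, by omega⟩, ⟨Multiset.replicate (m + 1) (1, j / 2) + t,
      ?_, ?_, ?_⟩), Or.inr ⟨m, j, t, hj, fun d hd => h d (Multiset.mem_cons_of_mem hd), ht,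
        rfl, rfl⟩⟩
    · intro x hx
      rcases Multiset.mem_add.1 hx with hx | hx
      · simp [Multiset.eq_of_mem_replicate hx]
      · exact hpos x (Multiset.mem_cons_of_mem hx)
    · intro x hx
      rcases Multiset.mem_add.1 hx with hx | hx
      · rw [Multiset.eq_of_mem_replicate hx]
        change j / 2 < 3
        omega
      · exact hcol x (Multiset.mem_cons_of_mem hx)
    · simp only [Multiset.map_add, Multiset.map_replicate, Multiset.sum_add,
        Multiset.sum_replicate, smul_eq_mul]
      omega

theorem Shrinks.left_unique {n : ℕ} {p p' : ColoredPartition 3 (n + 1)} {c : Fin 3}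
    {q : ColoredPartition 3 n} (h : Shrinks p c q) (h' : Shrinks p' c q) : p = p' := by
  apply parts_injective
  rcases h with ⟨hp, hq⟩ | ⟨m, j, t, hj, ht, hp, hc, hq⟩ <;>
    rcases h' with ⟨hp', hq'⟩ | ⟨m', j', t', hj', ht', hp', hc', hq'⟩
  · rw [hp, hp']
  · exact absurd (by simp [hq']) (hq (j' / 2) (by omega))
  · exact absurd (by simp [hq]) (hq' (j / 2) (by omega))
  · have he : j / 2 = j' / 2 := by
      have hmem : (1, j / 2) ∈ q.parts := by simp [hq]
      rw [hq', Multiset.mem_add, Multiset.mem_replicate] at hmem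
      rcases hmem with hmem | hmem
      · exact congrArg Prod.snd hmem.2
      · exact absurd hmem (ht' _)
    obtain rfl : j = j' := by omega
    have hm : m = m' := by
      have hcount := congrArg (Multiset.count (1, j / 2)) (hq.symm.trans hq')
      simpa [Multiset.count_eq_zero_of_notMem (ht _),
        Multiset.count_eq_zero_of_notMem (ht' _)] using hcount
    subst hm
    rw [hp, hp', add_left_cancel (hq.symm.trans hq')]

/-- The partition of `n + 2` into one part `1` of color `1` and `n + 1` parts `1` of color `0`. -/
def twoColoredOnes (n : ℕ) : ColoredPartition 3 (n + 2) where
  parts := (1, 1) ::ₘ Multiset.replicate (n + 1) (1, 0)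
  parts_pos := by simp [Multiset.mem_replicate]
  parts_color := by simp [Multiset.mem_replicate]
  parts_sum := by simp; omega

theorem not_shrinks_twoColoredOnes {n : ℕ} (p : ColoredPartition 3 (n + 2 + 1)) :
    ¬ Shrinks p 2 (twoColoredOnes n) := by
  have h0 : (1, 0) ∈ (twoColoredOnes n).parts := by simp [twoColoredOnes]
  have h1 : (1, 1) ∈ (twoColoredOnes n).parts := by simp [twoColoredOnes]
  rintro (⟨-, hq⟩ | ⟨m, j, t, hj, ht, -, -, hq⟩)
  · exact hq 0 (by simp) h0
  · rw [hq, Multiset.mem_add, or_iff_left (ht _)] at h0 h1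
    simpa using (Multiset.eq_of_mem_replicate h0).trans (Multiset.eq_of_mem_replicate h1).symm

end ColoredPartition

open ColoredPartition

theorem coloredPartitions_one (k : ℕ) : coloredPartitions k 1 = k := by
  rw [coloredPartitions, ← Nat.card_eq_of_bijective _ (single_bijective (k := k)), Nat.card_fin]

theorem coloredPartitions_three_succ_lt (n : ℕ) :
    coloredPartitions 3 (n + 2 + 1) < 3 * coloredPartitions 3 (n + 2) := by
  choose f hf using fun p : ColoredPartition 3 (n + 2 + 1) => exists_shrinks p
  have hinj : Function.Injective f := fun p p' h => (hf p).left_unique (h ▸ hf p')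
  have hsurj : ¬ Function.Surjective f := fun h => by
    obtain ⟨p, hp⟩ := h (2, twoColoredOnes n)
    exact not_shrinks_twoColoredOnes p (by simpa [hp] using hf p)
  have hcard : Nat.card (ColoredPartition 3 (n + 2 + 1)) <
      Nat.card (Fin 3 × ColoredPartition 3 (n + 2)) := by
    by_contra! hle
    exact hsurj (hinj.bijective_of_nat_card_le hle).surjective
  rwa [Nat.card_prod, Nat.card_fin] at hcard

theorem three_colored_add_one (a : ℕ) (ha : 2 ≤ a) :
    coloredPartitions 3 a * coloredPartitions 3 1 > coloredPartitions 3 (a + 1) ∧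
    3 * coloredPartitions 3 a > coloredPartitions 3 (a + 1) := by
  obtain ⟨n, rfl⟩ := Nat.exists_eq_add_of_le' ha
  have h := coloredPartitions_three_succ_lt n
  rw [coloredPartitions_one, mul_comm]
  exact ⟨h, h⟩
end
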